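/- arXiv:2511.21288 — 5 statements merged into one kernel-verified Lean document; each statement's English description precedes it below -/
import Mathlib

section
/- For every t ∈ [0,2] the following two statements hold: (i) h(x) ≤ h(t) for all x ≤ t; (ii) for every function φ : ℝ → ℝ that is concave on the half-line (−∞, t] and satisfies h(x) ≤ φ(x) for all x ≤ t, one has h(t) ≤ φ(x) for all x ≤ t. In other words, the constant function with value h(t) is the pointwise smallest function on (−∞, t] that is concave and dominates h there. -/
/-- The Clifford-type bound function for semistable bundles on smooth plane quintic curves. -/
noncomputable def h (x : ℝ) : ℝ :=
  if x < 0 then 0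
  else if x ≤ 6/7 then 1 + 3/2 * x
  else if x ≤ 1 then 5 * x - 2
  else if x ≤ 8/7 then 3
  else if x ≤ 2 then 7/2 * x - 1
  else 5 * x - 5

/-- Corollary 3.5: for `t ∈ [0,2]`, the constant function `h t` is the pointwise smallest
function on `(−∞, t]` that is concave there and dominates `h` there. -/
theorem convex_roof_of_h (t : ℝ) (ht : t ∈ Set.Icc (0:ℝ) 2) :
    (∀ x ≤ t, h x ≤ h t) ∧
    (∀ φ : ℝ → ℝ, ConcaveOn ℝ (Set.Iic t) φ → (∀ x ≤ t, h x ≤ φ x) →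
      ∀ x ≤ t, h t ≤ φ x) := by
  obtain ⟨h0, h2⟩ := ht
  refine ⟨?_, ?_⟩
  · intro x hx
    unfold h
    split_ifs <;> linarith
  · intro φ hc hd x hx
    by_contra hlt
    push Not at hlt
    have htt := hd t le_rfl
    have hxt : x < t := by
      rcases hx.lt_or_eq with h1 | h1
      · exact h1
      · subst h1; linarith
    have hpos : 0 < φ t - φ x := by linarith
    have key : ∀ d : ℝ, 0 < d → d * (φ t - φ x) ≤ φ x * (t - x) := by
      intro d hd0
      have hs := hc.slope_anti_adjacent (x := x - d) (y := x) (z := t)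
        (by simp only [Set.mem_Iic]; linarith) (by simp) (by linarith) hxt
      have hy : 0 ≤ φ (x - d) := by
        refine le_trans ?_ (hd (x - d) (by linarith))
        unfold h
        split_ifs <;> linarith
      rw [div_le_div_iff₀ (by linarith) (by linarith)] at hs
      nlinarith [mul_nonneg hy (sub_pos.mpr hxt).le]
    have hk := key ((|φ x * (t - x)| + 1) / (φ t - φ x)) (by positivity)
    rw [div_mul_cancel₀ _ hpos.ne'] at hk
    linarith [le_abs_self (φ x * (t - x))]
end

section
/- The function f is star-shaped along the line β = 1: for every t ∈ (0,1) and every λ ∈ (0,1], one has λ·f(t) + (1 − λ)·(1/2) ≥ f(λ·t + (1 − λ)). Equivalently, the segment joining the point (t, f(t)) to the point (1, 1/2) lies above the graph of f. -/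
/-- The stronger Bogomolov–Gieseker bound function for smooth quintic surfaces. -/
noncomputable def f (x : ℝ) : ℝ :=
  if x ≤ 7/46 then 17/26 * x - 2/13
  else if x ≤ 7/20 then -(5/14) * x
  else if x ≤ 13/20 then 1/2 * x - 3/10
  else if x ≤ 39/46 then 19/14 * x - 6/7
  else 9/26 * x

/-- `f` is star-shaped along the line `β = 1`. -/
theorem f_starShaped_one (t : ℝ) (ht : t ∈ Set.Ioo (0:ℝ) 1)
    (l : ℝ) (hl : l ∈ Set.Ioc (0:ℝ) 1) :
    l * f t + (1 - l) * (1/2) ≥ f (l * t + (1 - l)) := by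
  obtain ⟨h0, h1⟩ := ht
  obtain ⟨l0, l1⟩ := hl
  have hx : 0 ≤ (1 - l) * (1 - t) := mul_nonneg (by linarith) (by linarith)
  have key : ∀ c : ℝ, (t ≤ c → l * t ≤ l * c) ∧ (¬ t ≤ c → l * c ≤ l * t) := fun c =>
    ⟨fun h => mul_le_mul_of_nonneg_left h l0.le,
      fun h => mul_le_mul_of_nonneg_left (not_le.mp h).le l0.le⟩
  have k1 := key (7/46)
  have k2 := key (7/20)
  have k3 := key (13/20)
  have k4 := key (39/46)
  have k5 : l * t ≤ l := by nlinarith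
  clear key
  unfold f
  split_ifs <;> simp_all only [not_false_eq_true, forall_const, not_true_eq_false, not_le,
    false_imp_iff, and_true, true_and, true_imp_iff] <;> nlinarith
end

section
/- The function g is star-shaped along the line β = 0 on (0,1): for every t ∈ (0,1) and every λ ∈ (0,1], one has λ·g(t) ≥ g(λ·t). Equivalently, for t ∈ (0,1) the segment joining the point (t, g(t)) to the origin (0,0) lies above the graph of g. -/
/-- The stronger Bogomolov–Gieseker bound function for smooth quintic threefolds. -/
noncomputable def g (x : ℝ) : ℝ :=
  if |x| ≤ 1/4 then -(1/2) * |x|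
  else if |x| ≤ 5/13 then 1/2 * |x| - 1/4
  else if |x| ≤ 6/13 then -(3/20) * |x|
  else if |x| ≤ 7/13 then 1/2 * |x| - 3/10
  else if |x| ≤ 8/13 then 23/20 * |x| - 13/20
  else if |x| ≤ 3/4 then 1/2 * |x| - 1/4
  else 3/2 * |x| - 1

set_option maxHeartbeats 4000000 in
/-- `g` is star-shaped along the line `β = 0` on `(0,1)`. -/
theorem g_starShaped_zero (t : ℝ) (ht : t ∈ Set.Ioo (0:ℝ) 1)
    (l : ℝ) (hl : l ∈ Set.Ioc (0:ℝ) 1) :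
    l * g t ≥ g (l * t) := by
  obtain ⟨h0, h1⟩ := ht
  obtain ⟨l0, l1⟩ := hl
  have hs : 0 < l * t := mul_pos l0 h0
  have hst : l * t ≤ t := by nlinarith
  have key : ∀ p : ℝ, ¬ t ≤ p → l * p ≤ l * t := fun p hp =>
    mul_le_mul_of_nonneg_left (not_le.mp hp).le l0.le
  unfold g
  rw [abs_of_pos h0, abs_of_pos hs]
  have k1 := key (1/4)
  have k2 := key (5/13)
  have k3 := key (6/13)
  have k4 := key (7/13)
  have k5 := key (8/13)
  have k6 := key (3/4)
  clear key
  split_ifs <;> simp only [*, not_true_eq_false, not_false_eq_true, forall_const, false_imp_iff] at k1 k2 k3 k4 k5 k6 <;> linarith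
end

section
/- The function g is star-shaped along the line β = 1 on (0,1): for every t ∈ (0,1) and every λ ∈ (0,1], one has λ·g(t) + (1 − λ)·(1/2) ≥ g(λ·t + (1 − λ)). Equivalently, for t ∈ (0,1) the segment joining the point (t, g(t)) to the point (1, 1/2) lies above the graph of g. -/
set_option maxHeartbeats 1000000 in
theorem g_starShaped_one (t : ℝ) (ht : t ∈ Set.Ioo (0:ℝ) 1)
    (l : ℝ) (hl : l ∈ Set.Ioc (0:ℝ) 1) :
    l * g t + (1 - l) * (1/2) ≥ g (l * t + (1 - l)) := by
  obtain ⟨h0, h1⟩ := ht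
  obtain ⟨k0, k1⟩ := hl
  have p0 : 0 < l * t := mul_pos k0 h0
  have p1 : l * t < l * 1 := mul_lt_mul_of_pos_left h1 k0
  have hy : 0 < l * t + (1 - l) := by linarith
  have hc : ∀ c : ℝ, t ≤ c ↔ l * t ≤ l * c := fun c => (mul_le_mul_iff_right₀ k0).symm
  unfold g
  rw [abs_of_pos h0, abs_of_pos hy]
  simp only [hc (1/4), hc (5/13), hc (6/13), hc (7/13), hc (8/13),
    hc (3/4)]
  clear hc
  split_ifs <;> linarith
end

section
/- Let μ, ξ be real numbers with 7/46 ≤ μ ≤ 1/2, f(μ) ≤ ξ and ξ ≤ μ²/2. Then the following three inequalities hold: (1) ξ/μ + 1/2 ≤ 6/7; (2) (ξ − μ/2)/(μ − 1) ≤ 6/7; (3) 1/2 − ξ/μ ≤ 6/7. -/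
/-- Key numerical steps in the proof of Proposition 4.5. -/
theorem slope_bounds_quintic_surface (μ ξ : ℝ)
    (hμ₁ : 7/46 ≤ μ) (hμ₂ : μ ≤ 1/2) (hf : f μ ≤ ξ) (hBG : ξ ≤ μ ^ 2 / 2) :
    ξ / μ + 1/2 ≤ 6/7 ∧ (ξ - μ/2) / (μ - 1) ≤ 6/7 ∧ 1/2 - ξ / μ ≤ 6/7 := by
  have hpos : 0 < μ := by linarith
  have h3 : -(5/14) * μ ≤ ξ := by
    unfold f at hf
    split_ifs at hf <;> linarith
  have h2 : 19/14 * μ - 6/7 ≤ ξ := by linarith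
  have h1 : ξ ≤ 5/14 * μ := by nlinarith
  refine ⟨?_, ?_, ?_⟩
  · have : ξ / μ ≤ 5/14 := by rw [div_le_iff₀ hpos]; exact h1
    linarith
  · rw [div_le_iff_of_neg (by linarith)]
    linarith
  · have : -(5/14) ≤ ξ / μ := by rw [le_div_iff₀ hpos]; exact h3
    linarith
end
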